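/- Let n ≥ 1 and let p⃗, s⃗ be n-tuples with 1 ≤ pᵢ, sᵢ ≤ ∞, and let p⃗′, s⃗′ be the conjugate tuples (1/pᵢ + 1/pᵢ′ = 1 and 1/sᵢ + 1/sᵢ′ = 1 for each i). Then for every r ∈ (0,∞) and all locally integrable f, g on ℝⁿ: ‖fg‖_{L¹(ℝⁿ)} ≤ _r‖f‖_{p⃗,s⃗} · _r‖g‖_{p⃗′,s⃗′}. -/

import Mathlib

open MeasureTheory ENNReal Filter Topology Set

noncomputable section

namespace MixedAmalgam

/-- `L^p` norm over `ℝ` of an `ℝ≥0∞`-valued function, with the usual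
modification (`essSup`) for `p = ∞`. -/
def lpInt (p : ℝ≥0∞) (g : ℝ → ℝ≥0∞) : ℝ≥0∞ :=
  if p = ∞ then essSup g volume else (∫⁻ t, g t ^ p.toReal) ^ (1 / p.toReal)

/-- `ℓ^p` norm over `ℤ` of an `ℝ≥0∞`-valued family, with the usual
modification for `p = ∞`. -/
def lpSum (p : ℝ≥0∞) (g : ℤ → ℝ≥0∞) : ℝ≥0∞ :=
  if p = ∞ then ⨆ k, g k else (∑' k, g k ^ p.toReal) ^ (1 / p.toReal)

/-- Iterated mixed Lebesgue norm of an `ℝ≥0∞`-valued function on `ℝⁿ`,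
taking the `L^{p₁}` norm in the first variable innermost, and the `L^{pₙ}`
norm in the last variable outermost. -/
def mixedE : (n : ℕ) → (Fin n → ℝ≥0∞) → ((Fin n → ℝ) → ℝ≥0∞) → ℝ≥0∞
  | 0, _, g => g Fin.elim0
  | n + 1, p, g =>
    lpInt (p (Fin.last n)) fun t =>
      mixedE n (fun i => p i.castSucc) fun x => g (Fin.snoc x t)

/-- Mixed-norm Lebesgue norm `‖f‖_{L^{p⃗}}` of a real-valued function on `ℝⁿ`. -/
def mixedLp (n : ℕ) (p : Fin n → ℝ≥0∞) (f : (Fin n → ℝ) → ℝ) : ℝ≥0∞ :=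
  mixedE n p fun x => (‖f x‖₊ : ℝ≥0∞)

/-- Iterated mixed `ℓ^{s⃗}` norm of an `ℝ≥0∞`-valued family indexed by `ℤⁿ`. -/
def mixedSeq : (n : ℕ) → (Fin n → ℝ≥0∞) → ((Fin n → ℤ) → ℝ≥0∞) → ℝ≥0∞
  | 0, _, a => a Fin.elim0
  | n + 1, s, a =>
    lpSum (s (Fin.last n)) fun k =>
      mixedSeq n (fun i => s i.castSucc) fun m => a (Fin.snoc m k)

/-- Open Euclidean ball of center `y` and radius `r` in `ℝⁿ`. -/
def eball (n : ℕ) (y : Fin n → ℝ) (r : ℝ) : Set (Fin n → ℝ) :=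
  {x | Real.sqrt (∑ i, (x i - y i) ^ 2) < r}

/-- `Σᵢ 1/pᵢ` as a real number. -/
def invSum (n : ℕ) (p : Fin n → ℝ≥0∞) : ℝ :=
  ∑ i, (1 / p i).toReal

/-- The `(L^{p⃗},L^{s⃗})` amalgam norm computed with balls of radius `r`. -/
def amalgamNormR (n : ℕ) (p s : Fin n → ℝ≥0∞) (r : ℝ) (f : (Fin n → ℝ) → ℝ) : ℝ≥0∞ :=
  mixedE n s fun y => mixedLp n p ((eball n y r).indicator f)

/-- The amalgam norm `‖f‖_{(L^{p⃗},L^{s⃗})}`. -/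
def amalgamNorm (n : ℕ) (p s : Fin n → ℝ≥0∞) (f : (Fin n → ℝ) → ℝ) : ℝ≥0∞ :=
  amalgamNormR n p s 1 f

/-- The amalgam norm `‖f‖_{(L^{p⃗},L^{s⃗})^α}`. -/
def amalgamNormA (n : ℕ) (p s : Fin n → ℝ≥0∞) (α : ℝ≥0∞) (f : (Fin n → ℝ) → ℝ) : ℝ≥0∞ :=
  ⨆ (r : ℝ) (_ : 0 < r),
    mixedE n s fun y =>
      volume (eball n y r) ^
          ((1 / α).toReal - invSum n p / (n : ℝ) - invSum n s / (n : ℝ)) *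
        mixedLp n p ((eball n y r).indicator f)

/-- The amalgam norm `‖·‖_{(L^{p⃗},L^{s⃗})^α}` for `ℝ≥0∞`-valued functions. -/
def amalgamNormAE (n : ℕ) (p s : Fin n → ℝ≥0∞) (α : ℝ≥0∞)
    (g : (Fin n → ℝ) → ℝ≥0∞) : ℝ≥0∞ :=
  ⨆ (r : ℝ) (_ : 0 < r),
    mixedE n s fun y =>
      volume (eball n y r) ^
          ((1 / α).toReal - invSum n p / (n : ℝ) - invSum n s / (n : ℝ)) *
        mixedE n p ((eball n y r).indicator g)

/-- The cube `Q_{r,k} = r(k + [0,1)ⁿ)`. -/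
def qcube (n : ℕ) (r : ℝ) (k : Fin n → ℤ) : Set (Fin n → ℝ) :=
  {x | ∀ i, r * (k i : ℝ) ≤ x i ∧ x i < r * ((k i : ℝ) + 1)}

/-- The discrete amalgam norm `_r‖f‖_{p⃗,s⃗}`. -/
def discNormR (n : ℕ) (p s : Fin n → ℝ≥0∞) (r : ℝ) (f : (Fin n → ℝ) → ℝ) : ℝ≥0∞ :=
  mixedSeq n s fun k => mixedLp n p ((qcube n r k).indicator f)

/-- The discrete amalgam norm `‖f‖_{p⃗,s⃗} = _1‖f‖_{p⃗,s⃗}`. -/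
def discNorm (n : ℕ) (p s : Fin n → ℝ≥0∞) (f : (Fin n → ℝ) → ℝ) : ℝ≥0∞ :=
  discNormR n p s 1 f

/-- The discrete amalgam norm
`‖f‖_{p⃗,s⃗,α} = sup_{r>0} r^{n/α - Σᵢ 1/pᵢ} · _r‖f‖_{p⃗,s⃗}`. -/
def discNormA (n : ℕ) (p s : Fin n → ℝ≥0∞) (α : ℝ≥0∞) (f : (Fin n → ℝ) → ℝ) : ℝ≥0∞ :=
  ⨆ (r : ℝ) (_ : 0 < r),
    ENNReal.ofReal (r ^ ((n : ℝ) * (1 / α).toReal - invSum n p)) * discNormR n p s r f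

/-- Membership in `(L^{p⃗},L^{s⃗})^α(ℝⁿ)` (continuous form). -/
def memA (n : ℕ) (p s : Fin n → ℝ≥0∞) (α : ℝ≥0∞) (f : (Fin n → ℝ) → ℝ) : Prop :=
  LocallyIntegrable f volume ∧ amalgamNormA n p s α f < ∞

/-- Membership in `(L^{p⃗},ℓ^{s⃗})(ℝⁿ)`. -/
def memD (n : ℕ) (p s : Fin n → ℝ≥0∞) (f : (Fin n → ℝ) → ℝ) : Prop :=
  LocallyIntegrable f volume ∧ discNorm n p s f < ∞

/-- Membership in `(L^{p⃗},ℓ^{s⃗})^α(ℝⁿ)`. -/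
def memDA (n : ℕ) (p s : Fin n → ℝ≥0∞) (α : ℝ≥0∞) (f : (Fin n → ℝ) → ℝ) : Prop :=
  LocallyIntegrable f volume ∧ discNormA n p s α f < ∞

/-- The dilation `St_r^{(α)} f = r^{-n/α} f(r⁻¹ ·)`. -/
def dil (n : ℕ) (α : ℝ≥0∞) (r : ℝ) (f : (Fin n → ℝ) → ℝ) : (Fin n → ℝ) → ℝ :=
  fun x => r ^ (-((n : ℝ) * (1 / α).toReal)) * f (r⁻¹ • x)

/-- A block decomposition `f = Σ_j c_j St_{r_j}^{(α')} f_j` converging in `L¹_loc`. -/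
structure BlockDecomp (n : ℕ) (p' s' : Fin n → ℝ≥0∞) (α' : ℝ≥0∞) (f : (Fin n → ℝ) → ℝ)
    (c : ℕ → ℝ) (rr : ℕ → ℝ) (g : ℕ → (Fin n → ℝ) → ℝ) : Prop where
  csummable : Summable fun j => |c j|
  rpos : ∀ j, 0 < rr j
  gloc : ∀ j, LocallyIntegrable (g j) volume
  gnorm : ∀ j, discNorm n p' s' (g j) ≤ 1
  conv : ∀ K : Set (Fin n → ℝ), IsCompact K →
    Tendsto (fun J : ℕ =>
        ∫⁻ x in K,
          (‖f x - ∑ j ∈ Finset.range J, c j * dil n α' (rr j) (g j) x‖₊ : ℝ≥0∞))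
      atTop (𝓝 0)

/-- Membership in the block space `H(p⃗',s⃗',α')`. -/
def memH (n : ℕ) (p' s' : Fin n → ℝ≥0∞) (α' : ℝ≥0∞) (f : (Fin n → ℝ) → ℝ) : Prop :=
  LocallyIntegrable f volume ∧ ∃ c rr g, BlockDecomp n p' s' α' f c rr g

/-- The norm of the block space `H(p⃗',s⃗',α')`. -/
def hNorm (n : ℕ) (p' s' : Fin n → ℝ≥0∞) (α' : ℝ≥0∞) (f : (Fin n → ℝ) → ℝ) : ℝ≥0∞ :=
  ⨅ (c : ℕ → ℝ) (rr : ℕ → ℝ) (g : ℕ → (Fin n → ℝ) → ℝ)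
    (_ : BlockDecomp n p' s' α' f c rr g), ENNReal.ofReal (∑' j, |c j|)

/-- The fractional integral operator `I_γ`. -/
def fracInt (n : ℕ) (γ : ℝ) (f : (Fin n → ℝ) → ℝ) : (Fin n → ℝ) → ℝ :=
  fun x => ∫ y, f y / Real.sqrt (∑ i, (x i - y i) ^ 2) ^ ((n : ℝ) - γ)

/-- The fractional maximal operator `M_γ`. -/
def fracMax (n : ℕ) (γ : ℝ) (f : (Fin n → ℝ) → ℝ) : (Fin n → ℝ) → ℝ≥0∞ :=
  fun x => ⨆ (y : Fin n → ℝ) (r : ℝ) (_ : 0 < r) (_ : x ∈ eball n y r),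
    volume (eball n y r) ^ (γ / (n : ℝ) - 1) * ∫⁻ z in eball n y r, (‖f z‖₊ : ℝ≥0∞)

/-- The commutator `[b, I_γ] f`. -/
def commFracInt (n : ℕ) (γ : ℝ) (b f : (Fin n → ℝ) → ℝ) : (Fin n → ℝ) → ℝ :=
  fun x => ∫ y, (b x - b y) * f y / Real.sqrt (∑ i, (x i - y i) ^ 2) ^ ((n : ℝ) - γ)

/-- The mean value `b_B` of `b` over the ball `B(y,r)`. -/
def ballAvg (n : ℕ) (b : (Fin n → ℝ) → ℝ) (y : Fin n → ℝ) (r : ℝ) : ℝ :=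
  (volume (eball n y r)).toReal⁻¹ * ∫ x in eball n y r, b x

/-- The `BMO` norm `sup_B (1/|B|) ∫_B |b - b_B|`. -/
def bmoNorm (n : ℕ) (b : (Fin n → ℝ) → ℝ) : ℝ≥0∞ :=
  ⨆ (y : Fin n → ℝ) (r : ℝ) (_ : 0 < r),
    ENNReal.ofReal
      ((volume (eball n y r)).toReal⁻¹ * ∫ x in eball n y r, |b x - ballAvg n b y r|)

/-- Generic norm. -/
def lpG {α : Type*} [MeasurableSpace α] (μ : Measure α) (p : ℝ≥0∞) (g : α → ℝ≥0∞) : ℝ≥0∞ :=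
  if p = ∞ then essSup g μ else (∫⁻ t, g t ^ p.toReal ∂μ) ^ (1 / p.toReal)

theorem lpInt_eq (p : ℝ≥0∞) (g : ℝ → ℝ≥0∞) : lpInt p g = lpG volume p g := rfl

theorem lpSum_eq (p : ℝ≥0∞) (g : ℤ → ℝ≥0∞) : lpSum p g = lpG Measure.count p g := by
  unfold lpSum lpG
  split_ifs
  · simp
  · rw [lintegral_count]

theorem holder_top {α : Type*} [MeasurableSpace α] (μ : Measure α) (f g : α → ℝ≥0∞)
    (hf : AEMeasurable f μ) :
    ∫⁻ a, f a * g a ∂μ ≤ (∫⁻ a, f a ∂μ) * essSup g μ := by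
  rw [← lintegral_mul_const'' _ hf]
  apply lintegral_mono_ae
  filter_upwards [ENNReal.ae_le_essSup g] with a ha
  gcongr

theorem holderG {α : Type*} [MeasurableSpace α] (μ : Measure α) (p q : ℝ≥0∞)
    (h : 1 / p + 1 / q = 1) (f g : α → ℝ≥0∞)
    (hf : AEMeasurable f μ) (hg : AEMeasurable g μ) :
    ∫⁻ a, f a * g a ∂μ ≤ lpG μ p f * lpG μ q g := by
  simp only [one_div] at h
  by_cases hp : p = ∞
  · have hq : q = 1 := by simpa [hp] using h
    subst hp hq
    have := holder_top μ g f hg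
    simp only [lpG, if_true, ENNReal.one_ne_top, if_false, ENNReal.toReal_one, ENNReal.rpow_one,
      div_one]
    simp_rw [mul_comm (f _)]
    rwa [mul_comm (essSup f μ)]
  by_cases hq : q = ∞
  · have hp1 : p = 1 := by simpa [hq] using h
    subst hp1 hq
    simpa [lpG] using holder_top μ f g hf
  have hp0 : p ≠ 0 := by rintro rfl; simp at h
  have hq0 : q ≠ 0 := by rintro rfl; simp at h
  have hc : p.toReal.HolderConjugate q.toReal := by
    rw [Real.holderConjugate_iff]
    have h2 : p.toReal⁻¹ + q.toReal⁻¹ = 1 := by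
      have := congrArg ENNReal.toReal h
      rwa [ENNReal.toReal_add (by simpa) (by simpa), ENNReal.toReal_inv, ENNReal.toReal_inv,
        ENNReal.toReal_one] at this
    refine ⟨?_, h2⟩
    have a : 0 < p.toReal := ENNReal.toReal_pos hp0 hp
    have b : 0 < q.toReal⁻¹ := inv_pos.2 (ENNReal.toReal_pos hq0 hq)
    exact (inv_lt_one₀ a).1 (by linarith)
  simpa [lpG, hp, hq] using ENNReal.lintegral_mul_le_Lp_mul_Lq μ hc hf hg

theorem measurable_lpG {α : Type*} [MeasurableSpace α] (p : ℝ≥0∞) (g : α × ℝ → ℝ≥0∞)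
    (hg : Measurable g) : Measurable fun a => lpG (volume : Measure ℝ) p fun t => g (a, t) := by
  unfold lpG
  split_ifs with h
  · apply measurable_of_Iic
    intro c
    have : (fun a => essSup (fun t => g (a, t)) (volume : Measure ℝ)) ⁻¹' Iic c
        = (fun a => (volume : Measure ℝ) (Prod.mk a ⁻¹' {z | c < g z})) ⁻¹' {0} := by
      ext a
      simp only [mem_preimage, mem_Iic, mem_singleton_iff]
      have e : (∀ᵐ t, g (a, t) ≤ c) ↔ (volume : Measure ℝ) (Prod.mk a ⁻¹' {z | c < g z}) = 0 := by
        rw [ae_iff]; simp [preimage]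
      rw [← e]
      constructor
      · intro h
        filter_upwards [ENNReal.ae_le_essSup fun t => g (a, t)] with t ht using ht.trans h
      · intro h
        exact essSup_le_of_ae_le c h
    rw [this]
    exact measurable_measure_prodMk_left (measurableSet_lt measurable_const hg)
      (measurableSet_singleton 0)
  · exact ((hg.pow_const _).lintegral_prod_right').pow_const _

theorem measurable_snoc' (n : ℕ) :
    Measurable fun z : ℝ × (Fin n → ℝ) => (Fin.snoc z.2 z.1 : Fin (n + 1) → ℝ) := by
  rw [measurable_pi_iff]
  intro i
  refine Fin.lastCases ?_ (fun j => ?_) i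
  · simpa using measurable_fst
  · simp only [Fin.snoc_castSucc]
    exact (measurable_pi_apply j).comp measurable_snd

theorem measurable_mixedE (n : ℕ) : ∀ {α : Type} [MeasurableSpace α] (p : Fin n → ℝ≥0∞)
    (g : α × (Fin n → ℝ) → ℝ≥0∞), Measurable g →
    Measurable fun a => mixedE n p fun x => g (a, x) := by
  induction n with
  | zero =>
    intro α _ p g hg
    exact hg.comp (measurable_id.prodMk measurable_const)
  | succ n ih =>
    intro α _ p g hg
    simp only [mixedE, lpInt_eq]
    refine measurable_lpG _ (fun z : α × ℝ => mixedE n (fun i => p i.castSucc)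
      fun x => g (z.1, Fin.snoc x z.2)) ?_
    refine ih (α := α × ℝ) _ (fun z => g (z.1.1, Fin.snoc z.2 z.1.2)) ?_
    exact hg.comp ((measurable_fst.comp measurable_fst).prodMk
      ((measurable_snoc' n).comp ((measurable_snd.comp measurable_fst).prodMk measurable_snd)))

theorem mp_snoc (n : ℕ) :
    MeasurePreserving (fun z : ℝ × (Fin n → ℝ) => (Fin.snoc z.2 z.1 : Fin (n + 1) → ℝ))
      (volume.prod volume) volume := by
  have := (volume_preserving_piFinSuccAbove (fun _ : Fin (n + 1) => ℝ) (Fin.last n)).symm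
  have he : (fun z : ℝ × (Fin n → ℝ) => (Fin.snoc z.2 z.1 : Fin (n + 1) → ℝ))
      = ⇑(MeasurableEquiv.piFinSuccAbove (fun _ : Fin (n + 1) => ℝ) (Fin.last n)).symm := by
    funext z
    exact (Fin.insertNth_last' z.1 z.2).symm
  rw [he]
  exact this

theorem lpG_congr {α : Type*} [MeasurableSpace α] (μ : Measure α) (p : ℝ≥0∞) {f g : α → ℝ≥0∞}
    (h : f =ᵐ[μ] g) : lpG μ p f = lpG μ p g := by
  unfold lpG
  split_ifs
  · exact essSup_congr_ae h
  · congr 1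
    apply lintegral_congr_ae
    filter_upwards [h] with a ha
    rw [ha]

theorem mixedE_congr (n : ℕ) : ∀ (p : Fin n → ℝ≥0∞) (f g : (Fin n → ℝ) → ℝ≥0∞),
    f =ᵐ[volume] g → mixedE n p f = mixedE n p g := by
  induction n with
  | zero =>
    intro p f g h
    have h0 : (volume : Measure (Fin 0 → ℝ)) = Measure.dirac Fin.elim0 :=
      Measure.volume_pi_eq_dirac _
    rw [h0] at h
    have h2 : ∀ᵐ x ∂(Measure.dirac (Fin.elim0 : Fin 0 → ℝ)), f x = g x := h
    rw [ae_dirac_eq] at h2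
    exact h2
  | succ n ih =>
    intro p f g h
    simp only [mixedE, lpInt_eq]
    apply lpG_congr
    have h1 := (mp_snoc n).quasiMeasurePreserving.ae h
    filter_upwards [Measure.ae_ae_of_ae_prod h1] with t ht
    exact ih _ _ _ ht

theorem holder_mixedE (n : ℕ) : ∀ (p q : Fin n → ℝ≥0∞) (_ : ∀ i, 1 / p i + 1 / q i = 1)
    (f g : (Fin n → ℝ) → ℝ≥0∞), Measurable f → Measurable g →
    ∫⁻ x, f x * g x ≤ mixedE n p f * mixedE n q g := by
  induction n with
  | zero =>
    intro p q h f g hf hg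
    have h0 : (volume : Measure (Fin 0 → ℝ)) = Measure.dirac Fin.elim0 :=
      Measure.volume_pi_eq_dirac _
    rw [h0, lintegral_dirac' _ (by fun_prop)]
    exact le_rfl
  | succ n ih =>
    intro p q h f g hf hg
    have ms := measurable_snoc' n
    have hm : Measurable fun x => f x * g x := hf.mul hg
    have hm2 : Measurable fun z : ℝ × (Fin n → ℝ) =>
        f (Fin.snoc z.2 z.1) * g (Fin.snoc z.2 z.1) := hm.comp ms
    rw [← (mp_snoc n).lintegral_comp hm, lintegral_prod _ hm2.aemeasurable]
    simp only [mixedE, lpInt_eq]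
    refine le_trans (lintegral_mono fun t => ih (fun i => p i.castSucc) (fun i => q i.castSucc)
      (fun i => h _) (fun x => f (Fin.snoc x t)) (fun x => g (Fin.snoc x t))
      (hf.comp (ms.comp measurable_prodMk_left)) (hg.comp (ms.comp measurable_prodMk_left))) ?_
    exact holderG _ _ _ (h _) _ _
      (measurable_mixedE n _ (fun z => f (Fin.snoc z.2 z.1)) (hf.comp ms)).aemeasurable
      (measurable_mixedE n _ (fun z => g (Fin.snoc z.2 z.1)) (hg.comp ms)).aemeasurable

theorem holder_mixedE_ae (n : ℕ) (p q : Fin n → ℝ≥0∞) (h : ∀ i, 1 / p i + 1 / q i = 1)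
    (f g : (Fin n → ℝ) → ℝ≥0∞) (hf : AEMeasurable f volume) (hg : AEMeasurable g volume) :
    ∫⁻ x, f x * g x ≤ mixedE n p f * mixedE n q g := by
  have he : (fun x => f x * g x) =ᵐ[volume] fun x => hf.mk f x * hg.mk g x :=
    hf.ae_eq_mk.mul hg.ae_eq_mk
  rw [mixedE_congr n p _ _ hf.ae_eq_mk, mixedE_congr n q _ _ hg.ae_eq_mk,
    lintegral_congr_ae he]
  exact holder_mixedE n p q h _ _ hf.measurable_mk hg.measurable_mk

theorem holder_mixedSeq (n : ℕ) : ∀ (p q : Fin n → ℝ≥0∞) (_ : ∀ i, 1 / p i + 1 / q i = 1)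
    (f g : (Fin n → ℤ) → ℝ≥0∞),
    ∑' k, f k * g k ≤ mixedSeq n p f * mixedSeq n q g := by
  induction n with
  | zero =>
    intro p q h f g
    rw [tsum_eq_single Fin.elim0 (fun b hb => absurd (Subsingleton.elim _ _) hb)]
    exact le_rfl
  | succ n ih =>
    intro p q h f g
    rw [← (Fin.snocEquiv (fun _ : Fin (n + 1) => ℤ)).tsum_eq, ENNReal.tsum_prod']
    simp only [mixedSeq, lpSum_eq]
    refine le_trans (ENNReal.tsum_le_tsum fun t => ih (fun i => p i.castSucc)
      (fun i => q i.castSucc)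
      (fun i => h _) (fun x => f (Fin.snoc x t)) (fun x => g (Fin.snoc x t))) ?_
    rw [← lintegral_count]
    exact holderG _ _ _ (h _) _ _ (measurable_of_countable _).aemeasurable
      (measurable_of_countable _).aemeasurable

theorem measurableSet_qcube (n : ℕ) (r : ℝ) (k : Fin n → ℤ) : MeasurableSet (qcube n r k) := by
  unfold qcube
  rw [Set.ofPred_forall]
  refine MeasurableSet.iInter fun i => ?_
  exact (measurableSet_le measurable_const (measurable_pi_apply i)).inter
    (measurableSet_lt (measurable_pi_apply i) measurable_const)

theorem iUnion_qcube (n : ℕ) (r : ℝ) (hr : 0 < r) : ⋃ k, qcube n r k = univ := by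
  refine eq_univ_of_forall fun x => mem_iUnion.2 ⟨fun i => ⌊x i / r⌋, fun i => ⟨?_, ?_⟩⟩
  · rw [mul_comm, ← le_div_iff₀ hr]; exact Int.floor_le _
  · rw [mul_comm, ← div_lt_iff₀ hr]; exact Int.lt_floor_add_one _

/-- Hölder's inequality for the discrete amalgam norms:
`‖fg‖_{L¹} ≤ _r‖f‖_{p⃗,s⃗} · _r‖g‖_{p⃗',s⃗'}`. -/
theorem statement7 (n : ℕ) (hn : 1 ≤ n) (p s p' s' : Fin n → ℝ≥0∞)
    (hp : ∀ i, 1 ≤ p i) (hs : ∀ i, 1 ≤ s i)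
    (hp' : ∀ i, 1 / p i + 1 / p' i = 1) (hs' : ∀ i, 1 / s i + 1 / s' i = 1) :
    ∀ r : ℝ, 0 < r → ∀ f g : (Fin n → ℝ) → ℝ,
      LocallyIntegrable f volume → LocallyIntegrable g volume →
        ∫⁻ x, (‖f x * g x‖₊ : ℝ≥0∞) ≤ discNormR n p s r f * discNormR n p' s' r g := by
  intro r hr f g hf hg
  have hfm := hf.aestronglyMeasurable
  have hgm := hg.aestronglyMeasurable
  rw [← setLIntegral_univ, ← iUnion_qcube n r hr]
  refine (lintegral_iUnion_le _ _).trans ?_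
  refine le_trans (ENNReal.tsum_le_tsum fun k => ?_) (holder_mixedSeq n s s' hs' _ _)
  have hq := measurableSet_qcube n r k
  rw [← lintegral_indicator hq]
  refine le_trans (le_of_eq ?_) (holder_mixedE_ae n p p' hp' _ _
    (hfm.indicator hq).enorm (hgm.indicator hq).enorm)
  refine lintegral_congr fun x => ?_
  by_cases hx : x ∈ qcube n r k <;> simp [hx, enorm_mul, enorm]

end MixedAmalgam

end
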